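/- Hugoniot relation for the perpendicular rapidity: assume the Rankine–Hugoniot relation holds, W_I ≠ Z, and the positivity conditions μ_I + p_I > 0, μ_II + p_II > 0, μ_I + p_II > 0, μ_II + p_I > 0. Then sinh²(W_II − W_I) = (p_I − p_II)·(μ_I + (μ_I + p_I)|u∥_I|² − μ_II − (μ_II + p_II)|u∥_II|²) / ((μ_I + p_I)(μ_II + p_II)(1 + |u∥_I|²)(1 + |u∥_II|²)). -/

import Mathlib

open Real

/-- Squared Euclidean norm of a vector. -/
noncomputable def nsq {n : ℕ} (w : Fin n → ℝ) : ℝ := ∑ j, (w j) ^ 2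

/-- Minkowski bilinear form on `ℝ^{d+1}`: `η(x,y) = -x₀y₀ + ∑_{j=1}^d xⱼyⱼ`. -/
noncomputable def eta {d : ℕ} (x y : Fin (d + 1) → ℝ) : ℝ :=
  -(x 0 * y 0) + ∑ j : Fin d, x j.succ * y j.succ

/-- Unit spacelike normal `V = (sinh Z, cosh Z, 0, …, 0)` to the interface. -/
noncomputable def normalV (d : ℕ) (Z : ℝ) : Fin (d + 1) → ℝ := fun i =>
  if i.val = 0 then Real.sinh Z else if i.val = 1 then Real.cosh Z else 0

/-- Unit timelike fluid velocity determined by the perpendicular rapidity `W` and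
the parallel velocity `w ∈ ℝ^{d-1}`. -/
noncomputable def vel (d : ℕ) (W : ℝ) (w : Fin (d - 1) → ℝ) : Fin (d + 1) → ℝ := fun i =>
  if i.val = 0 then Real.sqrt (1 + nsq w) * Real.cosh W
  else if i.val = 1 then Real.sqrt (1 + nsq w) * Real.sinh W
  else if h : i.val - 2 < d - 1 then w ⟨i.val - 2, h⟩ else 0

/-- The Rankine–Hugoniot relation
`(μ_II + p_II) η(u_II,V) u_II − (μ_I + p_I) η(u_I,V) u_I + (p_II − p_I) V = 0`. -/
def RH (d : ℕ) (μI pI μII pII : ℝ) (uI uII V : Fin (d + 1) → ℝ) : Prop :=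
  ∀ i, (μII + pII) * eta uII V * uII i - (μI + pI) * eta uI V * uI i + (pII - pI) * V i = 0

theorem nsq_nonneg {n : ℕ} (w : Fin n → ℝ) : 0 ≤ nsq w :=
  Finset.sum_nonneg fun _ _ => sq_nonneg _

theorem eta_vel_normalV {d : ℕ} (hd : 1 ≤ d) (Z W : ℝ) (w : Fin (d - 1) → ℝ) :
    eta (vel d W w) (normalV d Z) = Real.sqrt (1 + nsq w) * Real.sinh (W - Z) := by
  obtain ⟨n, rfl⟩ := Nat.exists_eq_add_of_le' hd
  rw [eta, Fin.sum_univ_succ]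
  simp [vel, normalV, Real.sinh_sub]
  ring

/-- Boosting the components of the jump relation in the plane of the interface normal to the
rest frame of the interface. -/
theorem boosted_jump_relations {A B q Z a b : ℝ}
    (h0 : B * sinh b * cosh (b + Z) - A * sinh a * cosh (a + Z) + q * sinh Z = 0)
    (h1 : B * sinh b * sinh (b + Z) - A * sinh a * sinh (a + Z) + q * cosh Z = 0) :
    B * sinh b * cosh b = A * sinh a * cosh a ∧ q = A * sinh a ^ 2 - B * sinh b ^ 2 := by
  have hZ := Real.cosh_sq_sub_sinh_sq Z
  rw [Real.cosh_add, Real.cosh_add] at h0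
  rw [Real.sinh_add, Real.sinh_add] at h1
  constructor
  · linear_combination cosh Z * h0 - sinh Z * h1 -
      (B * sinh b * cosh b - A * sinh a * cosh a) * hZ
  · linear_combination cosh Z * h1 - sinh Z * h0 -
      (q - A * sinh a ^ 2 + B * sinh b ^ 2) * hZ

theorem mul_sinh_sub_sq_of_jump_relations {A B q a b : ℝ}
    (h : B * sinh b * cosh b = A * sinh a * cosh a)
    (hq : q = A * sinh a ^ 2 - B * sinh b ^ 2) :
    A * B * sinh (b - a) ^ 2 = -q * (A - B + q) := by
  have hAB : A - B + q = A * cosh a ^ 2 - B * cosh b ^ 2 := by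
    rw [Real.cosh_sq, Real.cosh_sq, hq]; ring
  rw [hAB, hq, Real.sinh_sub]
  linear_combination (B * sinh b * cosh b - A * sinh a * cosh a) * h

/-- Hugoniot relation for the perpendicular rapidity. -/
theorem hugoniot_perpendicular_rapidity (d : ℕ) (hd : 2 ≤ d) (Z μI μII pI pII WI WII : ℝ)
    (wI wII : Fin (d - 1) → ℝ) (hμI : 0 ≤ μI) (hμII : 0 ≤ μII)
    (hW : WI ≠ Z)
    (h1 : 0 < μI + pI) (h2 : 0 < μII + pII) (h3 : 0 < μI + pII) (h4 : 0 < μII + pI)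
    (hRH : RH d μI pI μII pII (vel d WI wI) (vel d WII wII) (normalV d Z)) :
    Real.sinh (WII - WI) ^ 2
      = (pI - pII) * (μI + (μI + pI) * nsq wI - μII - (μII + pII) * nsq wII)
        / ((μI + pI) * (μII + pII) * (1 + nsq wI) * (1 + nsq wII)) := by
  have hI : 0 < 1 + nsq wI := by linarith [nsq_nonneg wI]
  have hII : 0 < 1 + nsq wII := by linarith [nsq_nonneg wII]
  have sI := Real.mul_self_sqrt hI.le
  have sII := Real.mul_self_sqrt hII.le
  have e0 := hRH ⟨0, by omega⟩
  have e1 := hRH ⟨1, by omega⟩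
  rw [eta_vel_normalV (by omega), eta_vel_normalV (by omega)] at e0 e1
  simp only [vel, normalV, ↓reduceIte, one_ne_zero] at e0 e1
  obtain ⟨h, hq⟩ := boosted_jump_relations (A := (μI + pI) * (1 + nsq wI))
    (B := (μII + pII) * (1 + nsq wII)) (q := pII - pI) (Z := Z) (a := WI - Z) (b := WII - Z)
    (by
      rw [sub_add_cancel, sub_add_cancel]
      linear_combination e0 - (μII + pII) * sinh (WII - Z) * cosh WII * sII +
        (μI + pI) * sinh (WI - Z) * cosh WI * sI)
    (by
      rw [sub_add_cancel, sub_add_cancel]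
      linear_combination e1 - (μII + pII) * sinh (WII - Z) * sinh WII * sII +
        (μI + pI) * sinh (WI - Z) * sinh WI * sI)
  have key := mul_sinh_sub_sq_of_jump_relations h hq
  rw [sub_sub_sub_cancel_right] at key
  rw [eq_div_iff (by positivity)]
  linear_combination key
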